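/- Let l ≥ 1 and n ≥ 4l+2 be integers, and let (u_0, …, u_{2l+1}) be an inscribed equilateral (2l+1)-pointed star in P_n with side length r ∈ (0, r_n]. Then the number of indices i ∈ {0, 1, …, 2l} such that u_i is a vertex of P_n or a midpoint of an edge of P_n is equal to either 0 or gcd(n, 2l+1). -/

import Mathlib

noncomputable section

/-- The primitive `n`-th root of unity `ω = exp(2πi/n)`. -/
def nroot (n : ℕ) : ℂ := Complex.exp (2 * Real.pi * Complex.I / n)

/-- The boundary of the regular `n`-gon inscribed in the unit circle, as a subset of `ℂ`:
the union of the closed segments from `ω^j` to `ω^(j+1)` for `j = 0, …, n-1`. -/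
def polygon (n : ℕ) : Set ℂ :=
  ⋃ j ∈ Finset.range n, segment ℝ ((nroot n) ^ j) ((nroot n) ^ (j + 1))

/-- The critical scale `r_n`: `2 cos(π/n)` for even `n`,
and `1 + cos(2π/n)/cos(π/n)` for odd `n`. -/
def rpoly (n : ℕ) : ℝ :=
  if Even n then 2 * Real.cos (Real.pi / n)
  else 1 + Real.cos (2 * Real.pi / n) / Real.cos (Real.pi / n)

/-- Arc-length parametrization of the polygon `P_n` by the parameter `t` (normalized so that
`t ∈ [0,1)` traverses the polygon once counterclockwise, with vertices at `t = j/n`). -/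
def polyParam (n : ℕ) (t : ℝ) : ℂ :=
  ((1 - Int.fract (n * t) : ℝ) : ℂ) * (nroot n) ^ (⌊(n : ℝ) * t⌋) +
    ((Int.fract (n * t) : ℝ) : ℂ) * (nroot n) ^ (⌊(n : ℝ) * t⌋ + 1)

/-- The parameter value in `[0,1)` of a point `x ∈ P_n`. -/
def polyArg (n : ℕ) (x : ℂ) : ℝ :=
  sInf {t : ℝ | t ∈ Set.Ico (0 : ℝ) 1 ∧ polyParam n t = x}

/-- The normalized counterclockwise arc distance from `x` to `y` along `P_n`: the length of the
counterclockwise path along `P_n` from `x` to `y` divided by the total perimeter of `P_n`. -/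
def polyDist (n : ℕ) (x y : ℂ) : ℝ := Int.fract (polyArg n y - polyArg n x)

/-- `z` is strictly counterclockwise-between `x` and `y` on `P_n`. -/
def SCCWBtw (n : ℕ) (x z y : ℂ) : Prop :=
  0 < polyDist n x z ∧ polyDist n x z < polyDist n x y

/-- An inscribed equilateral `(2l+1)`-pointed star of side length `r` based at `p ∈ P_n`:
a tuple `(u 0, …, u (2l+1))` of points of `P_n` with `u 0 = u (2l+1) = p`, where consecutive
points are at Euclidean distance `r`, every point of `P_n` strictly counterclockwise-between
`u i` and `u (i+1)` is at distance `< r` from `u i`, and the total winding number is `l`. -/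
def IsStar (n l : ℕ) (r : ℝ) (p : ℂ) (u : ℕ → ℂ) : Prop :=
  u 0 = p ∧ u (2 * l + 1) = p ∧
  (∀ i ≤ 2 * l + 1, u i ∈ polygon n) ∧
  (∀ i ≤ 2 * l, dist (u i) (u (i + 1)) = r) ∧
  (∀ i ≤ 2 * l, ∀ z ∈ polygon n, SCCWBtw n (u i) z (u (i + 1)) → dist (u i) z < r) ∧
  (∑ i ∈ Finset.range (2 * l + 1), polyDist n (u i) (u (i + 1))) = (l : ℝ)

/-- `x` is a vertex of `P_n`. -/
def IsVertex (n : ℕ) (x : ℂ) : Prop := ∃ j < n, x = (nroot n) ^ j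

/-- `x` is the midpoint of an edge of `P_n`. -/
def IsMidpoint (n : ℕ) (x : ℂ) : Prop :=
  ∃ j < n, x = ((nroot n) ^ j + (nroot n) ^ (j + 1)) / 2

end

open Complex in
lemma nroot_zpow (n : ℕ) (k : ℤ) :
    nroot n ^ k = ⟨Real.cos (2 * k * (Real.pi / n)), Real.sin (2 * k * (Real.pi / n))⟩ := by
  have h : nroot n ^ k = exp ((2 * k * (Real.pi / n) : ℝ) * I) := by
    rw [nroot, ← Complex.exp_int_mul]
    congr 1
    push_cast
    ring
  apply Complex.ext
  · rw [h, exp_ofReal_mul_I_re]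
  · rw [h, exp_ofReal_mul_I_im]

lemma nroot_ne_zero (n : ℕ) : nroot n ≠ 0 := Complex.exp_ne_zero _

lemma norm_nroot_zpow (n : ℕ) (k : ℤ) : ‖nroot n ^ k‖ = 1 := by
  have h : nroot n = Complex.exp ((2 * (Real.pi / n) : ℝ) * Complex.I) := by
    rw [nroot]
    congr 1
    push_cast
    ring
  rw [norm_zpow, h, Complex.norm_exp_ofReal_mul_I, one_zpow]

lemma nroot_zpow_mul_self {n : ℕ} (hn : n ≠ 0) (k : ℤ) : nroot n ^ (k * n) = 1 := by
  have hn' : (n : ℝ) ≠ 0 := by exact_mod_cast hn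
  have h : 2 * ((k * n : ℤ) : ℝ) * (Real.pi / n) = k * (2 * Real.pi) := by
    push_cast
    field_simp
  rw [nroot_zpow, h, Real.cos_int_mul_two_pi,
    show Real.sin (k * (2 * Real.pi)) = 0 by simpa using Real.sin_add_int_mul_two_pi 0 k]
  rfl

/-- The parametrization of `P_n` whose value at the integer `k` is the vertex `ω^k`. -/
noncomputable def polygonPath (n : ℕ) (t : ℝ) : ℂ :=
  ((1 - Int.fract t : ℝ) : ℂ) * nroot n ^ ⌊t⌋ + ((Int.fract t : ℝ) : ℂ) * nroot n ^ (⌊t⌋ + 1)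

lemma polyParam_eq (n : ℕ) (t : ℝ) : polyParam n t = polygonPath n (n * t) := rfl

lemma polygonPath_intCast_add (n : ℕ) (k : ℤ) {s : ℝ} (h0 : 0 ≤ s) (h1 : s ≤ 1) :
    polygonPath n (k + s) =
      ((1 - s : ℝ) : ℂ) * nroot n ^ k + (s : ℂ) * nroot n ^ (k + 1) := by
  rcases h1.lt_or_eq with h | rfl
  · have hf : ⌊(k : ℝ) + s⌋ = k := by
      rw [Int.floor_intCast_add, Int.floor_eq_zero_iff.2 ⟨h0, h⟩, add_zero]
    rw [polygonPath, Int.fract, hf, add_sub_cancel_left]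
  · have hf : ⌊(k : ℝ) + 1⌋ = k + 1 := by rw [Int.floor_add_one, Int.floor_intCast]
    rw [polygonPath, Int.fract, hf]
    simp

lemma polygonPath_intCast (n : ℕ) (k : ℤ) : polygonPath n k = nroot n ^ k := by
  simpa using polygonPath_intCast_add n k le_rfl zero_le_one

lemma polygonPath_add_intCast (n : ℕ) (t : ℝ) (k : ℤ) :
    polygonPath n (t + k) = nroot n ^ k * polygonPath n t := by
  rw [polygonPath, polygonPath, Int.fract_add_intCast, Int.floor_add_intCast,
    show ⌊t⌋ + k + 1 = k + (⌊t⌋ + 1) by ring, add_comm ⌊t⌋ k,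
    zpow_add₀ (nroot_ne_zero n) k ⌊t⌋, zpow_add₀ (nroot_ne_zero n) k (⌊t⌋ + 1)]
  ring

lemma polygonPath_add_mul_self {n : ℕ} (hn : n ≠ 0) (t : ℝ) (k : ℤ) :
    polygonPath n (t + k * n) = polygonPath n t := by
  have := polygonPath_add_intCast n t (k * n)
  rw [nroot_zpow_mul_self hn, one_mul] at this
  rw [← this]
  push_cast
  rfl

lemma dist_polygonPath_add_intCast (n : ℕ) (s t : ℝ) (k : ℤ) :
    dist (polygonPath n (s + k)) (polygonPath n (t + k)) =
      dist (polygonPath n s) (polygonPath n t) := by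
  rw [polygonPath_add_intCast, polygonPath_add_intCast, dist_eq_norm, dist_eq_norm, ← mul_sub,
    norm_mul, norm_nroot_zpow, one_mul]

lemma polygonPath_neg (n : ℕ) (t : ℝ) :
    polygonPath n (-t) = (starRingEnd ℂ) (polygonPath n t) := by
  have hc : ∀ k : ℤ, nroot n ^ (-k) = (starRingEnd ℂ) (nroot n ^ k) := by
    intro k
    rw [nroot_zpow, nroot_zpow]
    apply Complex.ext <;> simp
  have h : -t = ((-(⌊t⌋ + 1) : ℤ) : ℝ) + (1 - Int.fract t) := by
    rw [Int.fract]
    push_cast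
    ring
  rw [h, polygonPath_intCast_add n _ (by linarith [Int.fract_lt_one t])
    (by linarith [Int.fract_nonneg t]), show -(⌊t⌋ + 1) + 1 = -⌊t⌋ by ring, hc, hc, polygonPath]
  simp only [map_add, map_mul, Complex.conj_ofReal]
  push_cast
  ring

lemma dist_polygonPath_neg (n : ℕ) (s t : ℝ) :
    dist (polygonPath n (-s)) (polygonPath n (-t)) =
      dist (polygonPath n s) (polygonPath n t) := by
  rw [polygonPath_neg, polygonPath_neg, Complex.dist_conj_conj]

lemma cos_sub_cos_odd_mul (a : ℝ) (k : ℤ) :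
    Real.cos a - Real.cos (2 * k * a - a) = 2 * Real.sin (k * a) * Real.sin ((k - 1) * a) := by
  rw [Real.cos_sub_cos, show (a + (2 * k * a - a)) / 2 = k * a by ring,
    show (a - (2 * k * a - a)) / 2 = -((k - 1) * a) by ring, Real.sin_neg]
  ring

lemma sin_intCast_mul_pos {n : ℕ} {k : ℤ} (h0 : 0 < k) (h1 : k < n) :
    0 < Real.sin (k * (Real.pi / n)) := by
  have h0' : (0 : ℝ) < k := by exact_mod_cast h0
  have h1' : (k : ℝ) < n := by exact_mod_cast h1
  have hn : (0 : ℝ) < n := h0'.trans h1'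
  apply Real.sin_pos_of_pos_of_lt_pi
  · have := Real.pi_pos
    positivity
  · rw [mul_div_assoc', div_lt_iff₀ hn, mul_comm]
    exact mul_lt_mul_of_pos_left h1' Real.pi_pos

lemma cos_odd_mul_lt {n : ℕ} {k : ℤ} (h0 : 2 ≤ k) (h1 : k < n) :
    Real.cos (2 * k * (Real.pi / n) - Real.pi / n) < Real.cos (Real.pi / n) := by
  have h := cos_sub_cos_odd_mul (Real.pi / n) k
  have h2 := sin_intCast_mul_pos (n := n) (k := k) (by lia) h1
  have h3 := sin_intCast_mul_pos (n := n) (k := k - 1) (by lia) (by lia)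
  push_cast at h3
  have := mul_pos (mul_pos two_pos h2) h3
  linarith

/-- The component of `z` along the outer normal of the edge from `1` to `ω`. -/
noncomputable def edgeNormal (n : ℕ) (z : ℂ) : ℝ :=
  z.re * Real.cos (Real.pi / n) + z.im * Real.sin (Real.pi / n)

lemma edgeNormal_polygonPath (n : ℕ) (k : ℤ) {s : ℝ} (h0 : 0 ≤ s) (h1 : s ≤ 1) :
    edgeNormal n (polygonPath n (k + s)) =
      (1 - s) * Real.cos (2 * k * (Real.pi / n) - Real.pi / n) +
        s * Real.cos (2 * (k + 1 : ℤ) * (Real.pi / n) - Real.pi / n) := by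
  rw [polygonPath_intCast_add n k h0 h1, edgeNormal, nroot_zpow, nroot_zpow, Real.cos_sub,
    Real.cos_sub]
  simp only [Complex.add_re, Complex.add_im, Complex.re_ofReal_mul, Complex.im_ofReal_mul]
  ring

lemma nroot_ne_one {n : ℕ} (hn : 3 ≤ n) : nroot n ≠ 1 := by
  intro h
  have h1 := nroot_zpow n 1
  rw [zpow_one, h] at h1
  have h2 := congrArg Complex.im h1
  have h3 := sin_intCast_mul_pos (n := n) (k := 2) (by lia) (by lia)
  simp at h2 h3
  linarith

lemma polygonPath_injOn {n : ℕ} (hn : 3 ≤ n) {s t : ℝ} (hs0 : 0 ≤ s) (hs1 : s < 1) (ht0 : 0 ≤ t)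
    (ht1 : t < n) (h : polygonPath n s = polygonPath n t) : s = t := by
  have hs : polygonPath n s = ((1 - s : ℝ) : ℂ) + (s : ℂ) * nroot n := by
    simpa using polygonPath_intCast_add n 0 hs0 hs1.le
  have hinj : ∀ τ : ℝ, ((1 - s : ℝ) : ℂ) + (s : ℂ) * nroot n =
      ((1 - τ : ℝ) : ℂ) + (τ : ℂ) * nroot n → s = τ := by
    intro τ hτ
    have h1 : ((s : ℂ) - τ) * (nroot n - 1) = 0 := by
      push_cast at hτ
      linear_combination hτ
    rcases mul_eq_zero.1 h1 with h2 | h2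
    · exact_mod_cast sub_eq_zero.1 h2
    · exact absurd (sub_eq_zero.1 h2) (nroot_ne_one hn)
  obtain ⟨k, τ, hτ0, hτ1, rfl⟩ : ∃ (k : ℤ) (τ : ℝ), 0 ≤ τ ∧ τ < 1 ∧ t = k + τ :=
    ⟨⌊t⌋, Int.fract t, Int.fract_nonneg t, Int.fract_lt_one t, (Int.floor_add_fract t).symm⟩
  have hk0 : 0 ≤ k := by
    have : (-1 : ℝ) < k := by linarith
    have : (-1 : ℤ) < k := by exact_mod_cast this
    lia
  have hk1 : k < n := by
    have : (k : ℝ) < n := by linarith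
    exact_mod_cast this
  have hN : edgeNormal n (polygonPath n s) = Real.cos (Real.pi / n) := by
    have := edgeNormal_polygonPath n 0 hs0 hs1.le
    rw [Int.cast_zero, zero_add] at this
    rw [this, show 2 * (0 : ℝ) * (Real.pi / n) - Real.pi / n = -(Real.pi / n) by simp,
      show 2 * ((0 + 1 : ℤ) : ℝ) * (Real.pi / n) - Real.pi / n = Real.pi / n by
        push_cast; ring, Real.cos_neg]
    ring
  rw [h, edgeNormal_polygonPath n k hτ0 hτ1.le] at hN
  rcases eq_or_lt_of_le hk0 with rfl | hk
  · have := polygonPath_intCast_add n 0 hτ0 hτ1.le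
    rw [hs, this] at h
    have := hinj τ (by simpa using h)
    simpa using this
  rcases eq_or_lt_of_le (show 1 ≤ k by lia) with rfl | hk
  · have h2 := cos_odd_mul_lt (n := n) (k := 1 + 1) (by lia) (by lia)
    have h3 : 2 * ((1 : ℤ) : ℝ) * (Real.pi / n) - Real.pi / n = Real.pi / n := by
      push_cast; ring
    rw [h3] at hN
    have hτ : τ = 0 := by
      by_contra hne
      have := mul_lt_mul_of_pos_left h2 (lt_of_le_of_ne hτ0 (Ne.symm hne))
      linarith
    subst hτ
    have h4 := polygonPath_intCast n 1
    rw [add_zero, hs, h4] at h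
    have := hinj 1 (by simpa using h)
    linarith
  · have h2 := cos_odd_mul_lt (n := n) (k := k) (by lia) hk1
    have h3 : Real.cos (2 * (k + 1 : ℤ) * (Real.pi / n) - Real.pi / n) ≤
        Real.cos (Real.pi / n) := by
      rcases eq_or_lt_of_le (show k + 1 ≤ n by lia) with he | hlt
      · have hn0 : (n : ℝ) ≠ 0 := by
          have : n ≠ 0 := by lia
          exact_mod_cast this
        have : 2 * ((k + 1 : ℤ) : ℝ) * (Real.pi / n) - Real.pi / n =
            2 * Real.pi - Real.pi / n := by
          rw [he]
          push_cast
          field_simp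
        rw [this, Real.cos_two_pi_sub]
      · exact (cos_odd_mul_lt (by lia) hlt).le
    have h4 := mul_lt_mul_of_pos_left h2 (sub_pos.2 hτ1)
    have h5 := mul_le_mul_of_nonneg_left h3 hτ0
    linarith

lemma eq_add_mul_of_polygonPath_eq {n : ℕ} (hn : 3 ≤ n) {s t : ℝ}
    (h : polygonPath n s = polygonPath n t) : ∃ k : ℤ, t = s + k * n := by
  have hn0 : n ≠ 0 := by lia
  have hnpos : (0 : ℝ) < n := by exact_mod_cast Nat.pos_of_ne_zero hn0
  set j := ⌊s⌋ with hj
  set k := ⌊(t - j) / n⌋ with hk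
  have h1 : polygonPath n (s - j) = polygonPath n (t - j - k * n) := by
    have h2 := polygonPath_add_intCast n s (-j)
    have h3 := polygonPath_add_intCast n t (-j)
    have h4 := polygonPath_add_mul_self hn0 (t - j) (-k)
    push_cast at h2 h3 h4
    rw [show t - j - k * n = t - j + -k * n by ring, h4, sub_eq_add_neg, sub_eq_add_neg, h2, h3, h]
  have hk1 := Int.floor_le ((t - j) / n)
  have hk2 := Int.lt_floor_add_one ((t - j) / n)
  rw [← hk, le_div_iff₀ hnpos] at hk1
  rw [← hk, div_lt_iff₀ hnpos] at hk2
  have := polygonPath_injOn hn (by linarith [Int.floor_le s]) (by linarith [Int.lt_floor_add_one s])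
    (by linarith) (by linarith) h1
  exact ⟨k, by linarith⟩

lemma polyArg_polygonPath {n : ℕ} (hn : 3 ≤ n) (t : ℝ) :
    polyArg n (polygonPath n t) = Int.fract (t / n) := by
  have hn0 : n ≠ 0 := by lia
  have hnr : (n : ℝ) ≠ 0 := by exact_mod_cast hn0
  have : {s : ℝ | s ∈ Set.Ico (0 : ℝ) 1 ∧ polyParam n s = polygonPath n t} =
      {Int.fract (t / n)} := by
    ext s
    simp only [Set.mem_ofPred_eq, Set.mem_singleton_iff, polyParam_eq]
    constructor
    · rintro ⟨⟨h0, h1⟩, h⟩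
      obtain ⟨k, hk⟩ := eq_add_mul_of_polygonPath_eq hn h
      rw [hk, show (n * s + k * n) / (n : ℝ) = s + k by field_simp, Int.fract_add_intCast,
        Int.fract_eq_self.2 ⟨h0, h1⟩]
    · rintro rfl
      refine ⟨⟨Int.fract_nonneg _, Int.fract_lt_one _⟩, ?_⟩
      rw [← polygonPath_add_mul_self hn0 t (-⌊t / n⌋)]
      congr 1
      rw [Int.fract]
      push_cast
      field_simp
      ring
  rw [polyArg, this, csInf_singleton]

lemma polyDist_polygonPath {n : ℕ} (hn : 3 ≤ n) (s t : ℝ) :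
    polyDist n (polygonPath n s) (polygonPath n t) = Int.fract ((t - s) / n) := by
  rw [polyDist, polyArg_polygonPath hn, polyArg_polygonPath hn, Int.fract_eq_fract]
  refine ⟨⌊s / n⌋ - ⌊t / n⌋, ?_⟩
  rw [Int.fract, Int.fract]
  push_cast
  ring

lemma polygonPath_mem_polygon {n : ℕ} (hn : n ≠ 0) (t : ℝ) : polygonPath n t ∈ polygon n := by
  have hn' : (0 : ℤ) < n := by lia
  set k := ⌊t⌋ / n
  set j := ⌊t⌋ % n
  have h0 : 0 ≤ j := Int.emod_nonneg _ hn'.ne'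
  have h1 : j < n := Int.emod_lt_of_pos _ hn'
  lift j to ℕ using h0 with m hm
  have ht : t = ((m : ℤ) + Int.fract t) + k * n := by
    have h2 : (m : ℤ) + n * k = ⌊t⌋ := by rw [hm]; exact Int.emod_add_mul_ediv _ _
    have h3 := Int.floor_add_fract t
    rw [← h2] at h3
    push_cast at h3 ⊢
    linarith
  rw [ht, polygonPath_add_mul_self hn,
    polygonPath_intCast_add n m (Int.fract_nonneg t) (Int.fract_lt_one t).le]
  simp only [polygon, Set.mem_iUnion, Finset.mem_range]
  refine ⟨m, by lia, 1 - Int.fract t, Int.fract t, by linarith [Int.fract_lt_one t],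
    Int.fract_nonneg t, by ring, ?_⟩
  rw [Complex.real_smul, Complex.real_smul]
  norm_cast

lemma exists_polygonPath_eq {n : ℕ} {x : ℂ} (hx : x ∈ polygon n) : ∃ t, polygonPath n t = x := by
  simp only [polygon, Set.mem_iUnion, Finset.mem_range] at hx
  obtain ⟨j, -, a, b, ha, hb, hab, rfl⟩ := hx
  refine ⟨(j : ℤ) + b, ?_⟩
  rw [polygonPath_intCast_add n j hb (by linarith), Complex.real_smul, Complex.real_smul,
    ← hab, add_sub_cancel_right]
  norm_cast

lemma isVertex_or_isMidpoint_polygonPath_iff {n : ℕ} (hn : 3 ≤ n) (t : ℝ) :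
    IsVertex n (polygonPath n t) ∨ IsMidpoint n (polygonPath n t) ↔ ∃ m : ℤ, 2 * t = m := by
  have hmid : ∀ j : ℤ, polygonPath n (j + 1 / 2) = (nroot n ^ j + nroot n ^ (j + 1)) / 2 := by
    intro j
    rw [polygonPath_intCast_add n j (by norm_num) (by norm_num)]
    push_cast
    ring
  constructor
  · rintro (⟨j, -, hj⟩ | ⟨j, -, hj⟩)
    · have := polygonPath_intCast n j
      rw [zpow_natCast, ← hj] at this
      obtain ⟨k, hk⟩ := eq_add_mul_of_polygonPath_eq hn this
      exact ⟨2 * (j + k * n), by rw [hk]; push_cast; ring⟩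
    · have := hmid j
      rw [zpow_natCast, show (j : ℤ) + 1 = (j + 1 : ℕ) by push_cast; rfl, zpow_natCast, ← hj] at this
      obtain ⟨k, hk⟩ := eq_add_mul_of_polygonPath_eq hn this
      exact ⟨2 * (j + k * n) + 1, by rw [hk]; push_cast; ring⟩
  · rintro ⟨m, hm⟩
    have hn0 : n ≠ 0 := by lia
    have hn' : (0 : ℤ) < n := by lia
    obtain ⟨c, hc⟩ := Int.even_or_odd' m
    set k := c / n
    set j := c % n
    have h0 : 0 ≤ j := Int.emod_nonneg _ hn'.ne'
    have h1 : j < n := Int.emod_lt_of_pos _ hn'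
    have h2 : j + n * k = c := Int.emod_add_mul_ediv _ _
    have h2' : (c : ℝ) = j + n * k := by rw [← h2]; push_cast; rfl
    lift j to ℕ using h0 with i
    rcases hc with rfl | rfl
    · left
      refine ⟨i, by lia, ?_⟩
      have ht : t = (i : ℤ) + k * n := by push_cast at hm h2' ⊢; linarith
      rw [ht, polygonPath_add_mul_self hn0, polygonPath_intCast, zpow_natCast]
    · right
      refine ⟨i, by lia, ?_⟩
      have ht : t = ((i : ℤ) + 1 / 2) + k * n := by push_cast at hm h2' ⊢; linarith
      rw [ht, polygonPath_add_mul_self hn0, hmid]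
      norm_cast

/-- The real inner product of `z - ω` with the vector `1 - ω` pointing back along the edge from
`1` to `ω`; it is nonpositive iff the angle at `ω` between `1` and `z` is not acute. -/
noncomputable def backInner (n : ℕ) (z : ℂ) : ℝ :=
  (z - nroot n).re * (1 - nroot n).re + (z - nroot n).im * (1 - nroot n).im

lemma nroot_eq (n : ℕ) :
    nroot n = ⟨Real.cos (2 * (Real.pi / n)), Real.sin (2 * (Real.pi / n))⟩ := by
  simpa using nroot_zpow n 1

lemma backInner_zpow (n : ℕ) (j : ℤ) :
    backInner n (nroot n ^ j) =
      -4 * Real.sin (Real.pi / n) * Real.cos (j * (Real.pi / n)) *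
        Real.sin ((j - 1) * (Real.pi / n)) := by
  rw [backInner, nroot_zpow, nroot_eq]
  simp only [Complex.sub_re, Complex.sub_im, Complex.one_re, Complex.one_im]
  set a := Real.pi / n
  rw [show 2 * (j : ℝ) * a = 2 * (j * a) by ring, show ((j : ℝ) - 1) * a = j * a - a by ring,
    Real.sin_sub, Real.cos_two_mul, Real.cos_two_mul, Real.sin_two_mul, Real.sin_two_mul]
  linear_combination
    (4 * Real.cos a ^ 2 - 4 * Real.cos (j * a) ^ 2) * Real.sin_sq_add_cos_sq a

lemma backInner_zpow_nonpos {n : ℕ} (hn : 3 ≤ n) {j : ℤ} (h1 : 1 ≤ j) (h2 : 2 * j ≤ n) :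
    backInner n (nroot n ^ j) ≤ 0 := by
  have hn0 : (0 : ℝ) < n := by
    have : 0 < n := by lia
    exact_mod_cast this
  have hs : 0 < Real.sin (Real.pi / n) := by
    simpa using sin_intCast_mul_pos (n := n) (k := 1) (by lia) (by lia)
  have hs' : 0 ≤ Real.sin ((j - 1) * (Real.pi / n)) := by
    rcases eq_or_lt_of_le h1 with rfl | h
    · simp
    · have := sin_intCast_mul_pos (n := n) (k := j - 1) (by lia) (by lia)
      push_cast at this
      exact this.le
  have h1' : (1 : ℝ) ≤ j := by exact_mod_cast h1
  have h2' : 2 * (j : ℝ) ≤ n := by exact_mod_cast h2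
  have hc : 0 ≤ Real.cos (j * (Real.pi / n)) := by
    have hp := Real.pi_pos
    apply Real.cos_nonneg_of_neg_pi_div_two_le_of_le
    · have : 0 ≤ j * (Real.pi / n) := by positivity
      linarith
    · rw [mul_div_assoc', div_le_iff₀ hn0]
      nlinarith
  rw [backInner_zpow]
  have := mul_nonneg (mul_nonneg hs.le hc) hs'
  linarith

lemma backInner_polygonPath (n : ℕ) (j : ℤ) {s : ℝ} (h0 : 0 ≤ s) (h1 : s ≤ 1) :
    backInner n (polygonPath n (j + s)) =
      (1 - s) * backInner n (nroot n ^ j) + s * backInner n (nroot n ^ (j + 1)) := by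
  rw [polygonPath_intCast_add n j h0 h1]
  simp only [backInner, Complex.add_re, Complex.add_im, Complex.sub_re, Complex.sub_im,
    Complex.re_ofReal_mul, Complex.im_ofReal_mul]
  ring

lemma backInner_polygonPath_nonpos {n : ℕ} (hn : 3 ≤ n) {t : ℝ} (h1 : 1 ≤ t)
    (h2 : 2 * (⌊t⌋ + 1) ≤ (n : ℤ)) : backInner n (polygonPath n t) ≤ 0 := by
  have hj : 1 ≤ ⌊t⌋ := Int.le_floor.2 (by simpa using h1)
  rw [← Int.floor_add_fract t,
    backInner_polygonPath n _ (Int.fract_nonneg t) (Int.fract_lt_one t).le]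
  have e1 := backInner_zpow_nonpos hn hj (by lia)
  have e2 := backInner_zpow_nonpos hn (j := ⌊t⌋ + 1) (by lia) h2
  have e3 := mul_nonneg (Int.fract_nonneg t) (neg_nonneg.2 e2)
  have e4 := mul_nonneg (sub_nonneg.2 (Int.fract_lt_one t).le) (neg_nonneg.2 e1)
  linarith

lemma backInner_nonpos_and_dist_eq_even {m : ℕ} (hm : 3 ≤ m) :
    (∀ t : ℝ, 1 ≤ t → t ≤ m → backInner (2 * m) (polygonPath (2 * m) t) ≤ 0) ∧
      dist (nroot (2 * m)) (polygonPath (2 * m) m) = 2 * Real.cos (Real.pi / (2 * m : ℕ)) := by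
  have hm0 : (m : ℝ) ≠ 0 := by
    have : m ≠ 0 := by lia
    exact_mod_cast this
  have hm' := polygonPath_intCast (2 * m) m
  rw [Int.cast_natCast] at hm'
  refine ⟨fun t h1 h2 => ?_, ?_⟩
  · rcases h2.eq_or_lt with rfl | h2
    · rw [hm']
      exact backInner_zpow_nonpos (by lia) (by lia) (by lia)
    · have : ⌊t⌋ < m := Int.floor_lt.2 (by simpa using h2)
      exact backInner_polygonPath_nonpos (by lia) h1 (by lia)
  · set a := Real.pi / (2 * m : ℕ) with ha
    have h : 2 * ((m : ℤ) : ℝ) * a = Real.pi := by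
      rw [ha]
      push_cast
      field_simp
    have hc : 0 < Real.cos a := by
      have hm1 : (3 : ℝ) ≤ m := by exact_mod_cast hm
      have hp := Real.pi_pos
      rw [Int.cast_natCast] at h
      apply Real.cos_pos_of_mem_Ioo
      constructor <;> nlinarith
    rw [hm', nroot_zpow, nroot_eq, ← ha, h, Complex.dist_eq,
      ← sq_eq_sq₀ (norm_nonneg _) (by positivity), Complex.sq_norm, Complex.normSq_apply]
    simp only [Complex.sub_re, Complex.sub_im, Real.cos_pi, Real.sin_pi]
    rw [Real.cos_two_mul, Real.sin_two_mul]
    linear_combination 4 * Real.cos a ^ 2 * Real.sin_sq_add_cos_sq a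

lemma backInner_nonpos_and_dist_eq_odd {m : ℕ} (hm : 2 ≤ m) {a : ℝ}
    (ha : a = Real.pi / (2 * m + 1 : ℕ)) :
    1 ≤ m + (1 - 1 / (2 * Real.cos a)) ∧
    (∀ t : ℝ, 1 ≤ t → t ≤ m + (1 - 1 / (2 * Real.cos a)) →
      backInner (2 * m + 1) (polygonPath (2 * m + 1) t) ≤ 0) ∧
      dist (nroot (2 * m + 1))
        (polygonPath (2 * m + 1) (m + (1 - 1 / (2 * Real.cos a)))) =
          1 + Real.cos (2 * a) / Real.cos a := by
  have hm1 : (2 : ℝ) ≤ m := by exact_mod_cast hm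
  have h : (2 * m + 1) * a = Real.pi := by
    rw [ha]
    push_cast
    field_simp
  have hp := Real.pi_pos
  have ha0 : 0 < a := by rw [ha]; positivity
  have ha1 : a < Real.pi / 3 := by nlinarith
  have hc : 1 / 2 < Real.cos a := by
    rw [← Real.cos_pi_div_three]
    exact Real.cos_lt_cos_of_nonneg_of_le_pi ha0.le (by linarith) ha1
  have hs : 0 < Real.sin a := Real.sin_pos_of_pos_of_lt_pi ha0 (by linarith)
  have hτ0 : 0 < 1 - 1 / (2 * Real.cos a) := by
    rw [sub_pos, div_lt_one (by linarith)]
    linarith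
  have hτ1 : 1 - 1 / (2 * Real.cos a) < 1 := by
    have : 0 < 1 / (2 * Real.cos a) := by positivity
    linarith
  have e1 : backInner (2 * m + 1) (nroot (2 * m + 1) ^ (m : ℤ)) =
      2 * Real.sin a * (Real.sin a - Real.sin (2 * a)) := by
    rw [backInner_zpow, ← ha]
    have h3 := Real.sin_sub_sin (2 * a) a
    have hA : ((m : ℤ) : ℝ) * a = Real.pi / 2 - a / 2 := by push_cast; linarith
    have hB : (((m : ℤ) : ℝ) - 1) * a = Real.pi / 2 - (3 * a / 2) := by push_cast; linarith
    rw [hA, hB, Real.cos_pi_div_two_sub, Real.sin_pi_div_two_sub]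
    rw [show (2 * a - a) / 2 = a / 2 by ring, show (2 * a + a) / 2 = 3 * a / 2 by ring] at h3
    linear_combination 2 * Real.sin a * h3
  have e2 : backInner (2 * m + 1) (nroot (2 * m + 1) ^ ((m : ℤ) + 1)) =
      2 * Real.sin a * Real.sin a := by
    rw [backInner_zpow, ← ha]
    have hA : (((m : ℤ) + 1 : ℤ) : ℝ) * a = a / 2 + Real.pi / 2 := by push_cast; linarith
    have hB : ((((m : ℤ) + 1 : ℤ) : ℝ) - 1) * a = Real.pi / 2 - a / 2 := by push_cast; linarith
    have h4 := Real.sin_two_mul (a / 2)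
    rw [show 2 * (a / 2) = a by ring] at h4
    rw [hA, hB, Real.cos_add_pi_div_two, Real.sin_pi_div_two_sub]
    linear_combination -2 * Real.sin a * h4
  refine ⟨by linarith, fun t h1 h2 => ?_, ?_⟩
  · have hle : ⌊t⌋ < (m : ℤ) + 1 := Int.floor_lt.2 (by push_cast; linarith)
    rcases (show ⌊t⌋ ≤ m by lia).eq_or_lt with he | hlt
    · have hf := Int.floor_add_fract t
      rw [he, Int.cast_natCast] at hf
      have e3 := backInner_polygonPath (2 * m + 1) m (Int.fract_nonneg t) (Int.fract_lt_one t).le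
      rw [Int.cast_natCast, hf, e1, e2] at e3
      rw [e3, Real.sin_two_mul]
      have e4 : 1 / (2 * Real.cos a) ≤ 1 - Int.fract t := by linarith
      rw [div_le_iff₀ (by linarith)] at e4
      have e5 := mul_le_mul_of_nonneg_left e4 (mul_nonneg hs.le hs.le)
      linarith
    · exact backInner_polygonPath_nonpos (by lia) h1 (by push_cast; lia)
  · have h5 := polygonPath_intCast_add (2 * m + 1) m hτ0.le hτ1.le
    rw [Int.cast_natCast] at h5
    have hA : 2 * ((m : ℤ) : ℝ) * a = Real.pi - a := by push_cast; linarith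
    have hB : 2 * ((m + 1 : ℤ) : ℝ) * a = a + Real.pi := by push_cast; linarith
    have h2a : -1 / 2 < Real.cos (2 * a) := by
      rw [Real.cos_two_mul]
      nlinarith
    have hr : 0 ≤ 1 + Real.cos (2 * a) / Real.cos a := by
      rw [Real.cos_two_mul]
      have : (2 * Real.cos a ^ 2 - 1) / Real.cos a = 2 * Real.cos a - 1 / Real.cos a := by
        field_simp
      have h6 : 1 / Real.cos a ≤ 2 := by
        rw [div_le_iff₀ (by linarith)]
        linarith
      rw [this]
      linarith
    rw [h5, nroot_zpow, nroot_zpow, nroot_eq, ← ha, hA, hB, Complex.dist_eq,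
      ← sq_eq_sq₀ (norm_nonneg _) hr, Complex.sq_norm, Complex.normSq_apply]
    simp only [Complex.sub_re, Complex.sub_im, Complex.add_re, Complex.add_im,
      Complex.re_ofReal_mul, Complex.im_ofReal_mul, Real.cos_pi_sub, Real.sin_pi_sub,
      Real.cos_add_pi, Real.sin_add_pi]
    rw [Real.cos_two_mul, Real.sin_two_mul]
    have hc0 : Real.cos a ≠ 0 := by linarith
    have hsc : Real.sin a ^ 2 = 1 - Real.cos a ^ 2 := Real.sin_sq a
    field_simp
    ring_nf
    rw [hsc]
    ring

lemma exists_backInner_nonpos {n : ℕ} (hn : 6 ≤ n) :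
    ∃ Y : ℝ, 1 ≤ Y ∧ (∀ t, 1 ≤ t → t ≤ Y → backInner n (polygonPath n t) ≤ 0) ∧
      dist (nroot n) (polygonPath n Y) = rpoly n := by
  obtain ⟨m, rfl | rfl⟩ := Nat.even_or_odd' n
  · obtain ⟨h1, h2⟩ := backInner_nonpos_and_dist_eq_even (m := m) (by lia)
    refine ⟨m, ?_, h1, ?_⟩
    · have : 1 ≤ m := by lia
      exact_mod_cast this
    · rw [h2, rpoly, if_pos (even_two_mul m)]
  · obtain ⟨h0, h1, h2⟩ := backInner_nonpos_and_dist_eq_odd (m := m) (by lia) rfl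
    refine ⟨_, h0, h1, ?_⟩
    rw [h2, rpoly, if_neg (Nat.not_even_two_mul_add_one m), mul_div_assoc]

lemma sq_dist_polygonPath_edge (n : ℕ) {x : ℝ} (h0 : 0 ≤ x) (h1 : x ≤ 1) (z : ℂ) :
    dist (polygonPath n x) z ^ 2 =
      dist (nroot n) z ^ 2 - 2 * (1 - x) * backInner n z + (1 - x) ^ 2 * ‖1 - nroot n‖ ^ 2 := by
  have hx : polygonPath n x = ((1 - x : ℝ) : ℂ) + (x : ℂ) * nroot n := by
    simpa using polygonPath_intCast_add n 0 h0 h1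
  rw [hx, Complex.dist_eq, Complex.dist_eq, Complex.sq_norm, Complex.sq_norm, Complex.sq_norm,
    backInner]
  simp only [Complex.normSq_apply, Complex.sub_re, Complex.sub_im, Complex.add_re, Complex.add_im,
    Complex.re_ofReal_mul, Complex.im_ofReal_mul, Complex.ofReal_re, Complex.ofReal_im,
    Complex.one_re, Complex.one_im]
  ring

lemma dist_polygonPath_lt_of_edge {n : ℕ} (hn : 3 ≤ n) {x x' y : ℝ} (hx : 0 ≤ x) (hxx : x < x')
    (hx' : x' ≤ 1) (hxy : x' ≤ y) (hy : 1 ≤ y → backInner n (polygonPath n y) ≤ 0) :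
    dist (polygonPath n x') (polygonPath n y) < dist (polygonPath n x) (polygonPath n y) := by
  have hpos : 0 < ‖1 - nroot n‖ ^ 2 := by
    have := norm_pos_iff.2 (sub_ne_zero.2 (nroot_ne_one hn).symm)
    positivity
  rw [← sq_lt_sq₀ dist_nonneg dist_nonneg, sq_dist_polygonPath_edge n hx (by linarith),
    sq_dist_polygonPath_edge n (by linarith) hx']
  have hL : backInner n (polygonPath n y) ≤ (1 - x') * ‖1 - nroot n‖ ^ 2 := by
    rcases le_total 1 y with h | h
    · have := mul_nonneg (sub_nonneg.2 hx') hpos.le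
      linarith [hy h]
    · have h0 := polygonPath_intCast_add n 0 (show 0 ≤ y by linarith) h
      have : backInner n (polygonPath n y) = (1 - y) * ‖1 - nroot n‖ ^ 2 := by
        rw [Int.cast_zero, zero_add] at h0
        rw [h0, Complex.sq_norm, backInner]
        simp only [Complex.normSq_apply, Complex.sub_re, Complex.sub_im, Complex.add_re,
          Complex.add_im, Complex.re_ofReal_mul, Complex.im_ofReal_mul, zpow_zero, zero_add,
          zpow_one, Complex.one_re, Complex.one_im]
        ring
      rw [this]
      exact mul_le_mul_of_nonneg_right (by linarith) hpos.le
  have h1 := mul_le_mul_of_nonneg_left hL (sub_nonneg.2 hxx.le)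
  have h2 := mul_pos (mul_pos (sub_pos.2 hxx) (sub_pos.2 hxx)) hpos
  nlinarith

/-- If `Y` bounds the part of the polygon seen from the vertex `ω` at a non-acute angle to the
preceding edge, then the distance to `y` strictly decreases along the polygon towards `y`. -/
lemma dist_polygonPath_lt {n : ℕ} (hn : 3 ≤ n) {Y : ℝ}
    (hY : ∀ t, 1 ≤ t → t ≤ Y → backInner n (polygonPath n t) ≤ 0) {x x' y : ℝ} (hxx : x < x')
    (hxy : x' ≤ y) (hy : y ≤ ⌊x⌋ + Y) :
    dist (polygonPath n x') (polygonPath n y) < dist (polygonPath n x) (polygonPath n y) := by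
  have edge : ∀ (k : ℤ) (x x' : ℝ), k ≤ x → x < x' → x' ≤ k + 1 → x' ≤ y → y ≤ k + Y →
      dist (polygonPath n x') (polygonPath n y) < dist (polygonPath n x) (polygonPath n y) := by
    intro k x x' hk hxx hx' hxy hy
    rw [← dist_polygonPath_add_intCast n x' y (-k), ← dist_polygonPath_add_intCast n x y (-k)]
    push_cast
    exact dist_polygonPath_lt_of_edge hn (by linarith) (by linarith) (by linarith) (by linarith)
      (fun h => hY _ h (by linarith))
  have key : ∀ (m : ℕ) (x : ℝ), x < x' → x' ≤ ⌊x⌋ + 1 + m → y ≤ ⌊x⌋ + Y →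
      dist (polygonPath n x') (polygonPath n y) < dist (polygonPath n x) (polygonPath n y) := by
    intro m
    induction m with
    | zero =>
      intro x hxx hm hy
      exact edge ⌊x⌋ x x' (Int.floor_le x) hxx (by simpa using hm) hxy hy
    | succ m ih =>
      intro x hxx hm hy
      rcases le_or_gt x' (⌊x⌋ + 1) with h | h
      · exact edge ⌊x⌋ x x' (Int.floor_le x) hxx h hxy hy
      · have h1 := edge ⌊x⌋ x (⌊x⌋ + 1) (Int.floor_le x) (Int.lt_floor_add_one x) le_rfl
          (by linarith) hy
        have hf : ⌊(⌊x⌋ : ℝ) + 1⌋ = ⌊x⌋ + 1 := by rw [Int.floor_add_one, Int.floor_intCast]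
        refine (ih (⌊x⌋ + 1) h ?_ ?_).trans h1
        · rw [hf]
          push_cast at hm ⊢
          linarith
        · rw [hf]
          push_cast
          linarith
  obtain ⟨m, hm⟩ := exists_nat_ge (x' - ⌊x⌋ - 1)
  exact key m x hxx (by linarith) hy

/-- In the parametrization `polygonPath n`, the point at parameter `y` is the first point
counterclockwise from the point at parameter `x` at distance `r` from it. -/
def IsStep (n : ℕ) (r x y : ℝ) : Prop :=
  x < y ∧ dist (polygonPath n x) (polygonPath n y) = r ∧
    ∀ z, x < z → z < y → dist (polygonPath n x) (polygonPath n z) < r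

namespace IsStep

variable {n : ℕ} {r x y x' y' : ℝ}

lemma add_intCast (h : IsStep n r x y) (k : ℤ) : IsStep n r (x + k) (y + k) := by
  obtain ⟨h1, h2, h3⟩ := h
  refine ⟨by linarith, by rw [dist_polygonPath_add_intCast, h2], fun z hz1 hz2 => ?_⟩
  rw [← sub_add_cancel z (k : ℝ), dist_polygonPath_add_intCast]
  exact h3 _ (by linarith) (by linarith)

lemma eq_of_left_eq (h : IsStep n r x y) (h' : IsStep n r x y') : y = y' := by
  rcases lt_trichotomy y y' with hlt | heq | hlt
  · exact absurd h.2.1 (h'.2.2 _ h.1 hlt).ne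
  · exact heq
  · exact absurd h'.2.1 (h.2.2 _ h'.1 hlt).ne

lemma dist_lt (hn : 6 ≤ n) (hr : r ≤ rpoly n) (h : IsStep n r x y) {z : ℝ} (hx : x < x')
    (hxz : x' ≤ z) (hz : z ≤ y) : dist (polygonPath n x') (polygonPath n z) < r := by
  obtain ⟨Y, hY1, hY, hYr⟩ := exists_backInner_nonpos hn
  obtain ⟨h1, h2, h3⟩ := h
  have hyY : y ≤ ⌊x⌋ + Y := by
    by_contra! hlt
    have hfl := Int.lt_floor_add_one x
    have hfl' := Int.floor_le x
    have e1 := h3 (⌊x⌋ + Y) (by linarith) hlt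
    have e2 := dist_polygonPath_add_intCast n x (⌊x⌋ + Y) (-⌊x⌋)
    rw [show ⌊x⌋ + Y + ((-⌊x⌋ : ℤ) : ℝ) = Y by push_cast; ring,
      show x + ((-⌊x⌋ : ℤ) : ℝ) = x - ⌊x⌋ by push_cast; ring] at e2
    rw [← e2] at e1
    have e3 := sq_dist_polygonPath_edge n (x := x - ⌊x⌋) (by linarith) (by linarith)
      (polygonPath n Y)
    have e4 := mul_nonneg (show 0 ≤ 1 - (x - ⌊x⌋) by linarith) (neg_nonneg.2 (hY Y hY1 le_rfl))
    have e5 : 0 ≤ (1 - (x - ⌊x⌋)) ^ 2 * ‖1 - nroot n‖ ^ 2 := by positivity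
    have e6 : dist (nroot n) (polygonPath n Y) ≤
        dist (polygonPath n (x - ⌊x⌋)) (polygonPath n Y) :=
      (sq_le_sq₀ dist_nonneg dist_nonneg).1 (by linarith)
    linarith
  refine (dist_polygonPath_lt (by lia) hY hx hxz (hz.trans hyY)).trans_le ?_
  rcases hz.eq_or_lt with rfl | hlt
  · exact h2.le
  · exact (h3 z (hx.trans_le hxz) hlt).le

lemma neg (hn : 6 ≤ n) (hr : r ≤ rpoly n) (h : IsStep n r x y) : IsStep n r (-y) (-x) := by
  refine ⟨neg_lt_neg h.1, by rw [dist_polygonPath_neg, dist_comm, h.2.1], fun z hz1 hz2 => ?_⟩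
  rw [← neg_neg z, dist_polygonPath_neg, dist_comm]
  exact h.dist_lt hn hr (by linarith) (by linarith) le_rfl

lemma lt_of_left_lt (hn : 6 ≤ n) (hr : r ≤ rpoly n) (h : IsStep n r x y) (h' : IsStep n r x' y')
    (hlt : x < x') : y < y' := by
  by_contra! hle
  exact absurd h'.2.1 (h.dist_lt hn hr hlt h'.1.le hle).ne

end IsStep

/-- A relation on `ℝ` which behaves like the graph of a strictly increasing partial function
commuting with integer translations, and whose inverse is conjugate to it under `x ↦ -x`. -/
structure IsReflectiveStep (R : ℝ → ℝ → Prop) : Prop where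
  add_intCast : ∀ {x y : ℝ}, R x y → ∀ k : ℤ, R (x + k) (y + k)
  neg : ∀ {x y : ℝ}, R x y → R (-y) (-x)
  eq : ∀ {x y y' : ℝ}, R x y → R x y' → y = y'
  lt : ∀ {x y x' y' : ℝ}, R x y → R x' y' → x < x' → y < y'

namespace IsReflectiveStep

variable {R : ℝ → ℝ → Prop} {X : ℤ → ℝ}

lemma orbit_lt (hR : IsReflectiveStep R) {A B : ℕ → ℝ} (hA : ∀ i, R (A i) (A (i + 1)))
    (hB : ∀ i, R (B i) (B (i + 1))) (h : A 0 < B 0) (i : ℕ) : A i < B i := by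
  induction i with
  | zero => exact h
  | succ i ih => exact hR.lt (hA i) (hB i) ih

lemma orbit_eq (hR : IsReflectiveStep R) {A B : ℕ → ℝ} (hA : ∀ i, R (A i) (A (i + 1)))
    (hB : ∀ i, R (B i) (B (i + 1))) (h : A 0 = B 0) (i : ℕ) : A i = B i := by
  induction i with
  | zero => exact h
  | succ i ih =>
    have h2 := hB i
    rw [← ih] at h2
    exact hR.eq (hA i) h2

lemma shift (hX : ∀ i, R (X i) (X (i + 1))) (j : ℤ) (k : ℕ) :
    R (X (j + k)) (X (j + (k + 1 : ℕ))) := by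
  have := hX (j + k)
  rwa [show j + (k : ℤ) + 1 = j + (k + 1 : ℕ) by push_cast; ring] at this

/-- An orbit whose `d`-fold iterated shift by `q` is the translation by `d * p` is itself
shifted by `q` under the translation by `p`. -/
lemma apply_add_eq (hR : IsReflectiveStep R) (hX : ∀ i, R (X i) (X (i + 1))) {d q p : ℕ}
    (hd : 0 < d) (hper : ∀ i, X (i + d * q) = X i + d * p) (i : ℤ) : X (i + q) = X i + p := by
  have hA : ∀ k : ℕ, R (X (i + q + k)) (X (i + q + (k + 1 : ℕ))) := fun k => shift hX _ k
  have hB : ∀ k : ℕ, R (X (i + k) + p) (X (i + (k + 1 : ℕ)) + p) := fun k => by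
    simpa using hR.add_intCast (shift hX i k) p
  have hd' : ((d - 1 + 1 : ℕ) : ℤ) = d := by lia
  have hd'' : ((d - 1 + 1 : ℕ) : ℝ) = d := by exact_mod_cast hd'
  rcases lt_trichotomy (X (i + q)) (X i + p) with h | h | h
  · have hlt := hR.orbit_lt hA hB (by simpa using h)
    have : ∀ m : ℕ, X (i + (m + 1 : ℕ) * q) < X i + (m + 1 : ℕ) * p := by
      intro m
      induction m with
      | zero => simpa using h
      | succ m ih =>
        have := hlt ((m + 1) * q)
        rw [show i + (q : ℤ) + ((m + 1) * q : ℕ) = i + (m + 1 + 1 : ℕ) * q by push_cast; ring,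
          show i + (((m + 1) * q : ℕ) : ℤ) = i + (m + 1 : ℕ) * q by push_cast; ring] at this
        push_cast at this ih ⊢
        linarith
    have := this (d - 1)
    rw [hd', hd'', hper] at this
    exact absurd this (lt_irrefl _)
  · exact h
  · have hlt := hR.orbit_lt hB hA (by simpa using h)
    have : ∀ m : ℕ, X i + (m + 1 : ℕ) * p < X (i + (m + 1 : ℕ) * q) := by
      intro m
      induction m with
      | zero => simpa using h
      | succ m ih =>
        have := hlt ((m + 1) * q)
        rw [show i + (q : ℤ) + ((m + 1) * q : ℕ) = i + (m + 1 + 1 : ℕ) * q by push_cast; ring,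
          show i + (((m + 1) * q : ℕ) : ℤ) = i + (m + 1 : ℕ) * q by push_cast; ring] at this
        push_cast at this ih ⊢
        linarith
    have := this (d - 1)
    rw [hd', hd'', hper] at this
    exact absurd this (lt_irrefl _)

lemma apply_add_mul_eq {q p : ℕ} (hper : ∀ i, X (i + q) = X i + p) (i k : ℤ) :
    X (i + k * q) = X i + k * p := by
  induction k using Int.induction_on with
  | zero => simp
  | succ k ih =>
    rw [show i + ((k : ℤ) + 1) * q = i + k * q + q by ring, hper, ih]
    push_cast
    ring
  | pred k ih =>
    have := hper (i + (-(k : ℤ) - 1) * q)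
    rw [show i + (-(k : ℤ) - 1) * q + q = i + -k * q by ring, ih] at this
    push_cast at this ⊢
    linarith

lemma dvd_of_apply_eq_add (hR : IsReflectiveStep R) (hX : ∀ i, R (X i) (X (i + 1))) {q p : ℕ}
    (hqp : Nat.Coprime q p) (hper : ∀ i, X (i + q) = X i + p) {i j m : ℤ}
    (h : X i = X j + m) : (q : ℤ) ∣ i - j := by
  wlog hij : j ≤ i generalizing i j m
  · rw [← dvd_neg, neg_sub]
    exact this (m := -m) (by push_cast; linarith) (by lia)
  obtain ⟨s, hs⟩ := Int.eq_ofNat_of_zero_le (sub_nonneg.2 hij)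
  have heq : ∀ k : ℕ, X (i + k) = X (j + k) + m :=
    hR.orbit_eq (A := fun k : ℕ => X (i + k)) (B := fun k : ℕ => X (j + k) + m)
      (fun k => shift hX i k) (fun k => hR.add_intCast (shift hX j k) m) (by simpa using h)
  have hit : ∀ t : ℕ, X (j + (t * s : ℕ)) = X j + t * m := by
    intro t
    induction t with
    | zero => simp
    | succ t ih =>
      have := heq (t * s)
      rw [ih, show i = j + s by lia] at this
      rw [show j + (((t + 1) * s : ℕ) : ℤ) = j + s + (t * s : ℕ) by push_cast; ring, this]
      push_cast
      ring
  have h1 := hit q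
  have h2 := apply_add_mul_eq hper j s
  rw [show j + (s : ℤ) * q = j + (q * s : ℕ) by push_cast; ring, h1] at h2
  have h3 : (q : ℤ) * m = s * p := by
    have : (q : ℝ) * m = s * p := by push_cast at h2; linarith
    exact_mod_cast this
  rw [hs]
  exact IsCoprime.dvd_of_dvd_mul_right (Nat.isCoprime_iff_coprime.2 hqp) ⟨m, h3.symm⟩

lemma apply_add_add_apply_sub (hR : IsReflectiveStep R) (hX : ∀ i, R (X i) (X (i + 1))) {i m : ℤ}
    (h : 2 * X i = m) (k : ℤ) : X (i + k) + X (i - k) = m := by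
  have key : ∀ k : ℕ, X (i + k) = -X (i - k) + m := by
    refine hR.orbit_eq (A := fun k : ℕ => X (i + k)) (B := fun k : ℕ => -X (i - k) + m)
      (fun k => shift hX i k) (fun k => hR.add_intCast (hR.neg ?_) m) ?_
    · have := hX (i - (k + 1 : ℕ))
      rwa [show i - ((k + 1 : ℕ) : ℤ) + 1 = i - k by push_cast; ring] at this
    · simp only [Nat.cast_zero, add_zero, sub_zero]
      linarith
  rcases le_total 0 k with hk | hk
  · lift k to ℕ using hk
    linarith [key k]
  · obtain ⟨s, hs⟩ := Int.eq_ofNat_of_zero_le (neg_nonneg.2 hk)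
    have := key s
    rw [← hs, sub_neg_eq_add, ← sub_eq_add_neg] at this
    linarith

lemma dvd_of_two_mul_eq (hR : IsReflectiveStep R) (hX : ∀ i, R (X i) (X (i + 1))) {q p : ℕ}
    (hq : Odd q) (hqp : Nat.Coprime q p) (hper : ∀ i, X (i + q) = X i + p) {i j m m' : ℤ}
    (hi : 2 * X i = m) (hj : 2 * X j = m') : (q : ℤ) ∣ i - j := by
  have h1 := hR.apply_add_add_apply_sub hX hi (j - i)
  rw [add_sub_cancel] at h1
  have h2 : X (i - (j - i)) = X j + (m - m' : ℤ) := by push_cast; linarith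
  have h3 := hR.dvd_of_apply_eq_add hX hqp hper h2
  rw [show i - (j - i) - j = 2 * (i - j) by ring] at h3
  refine IsCoprime.dvd_of_dvd_mul_left ?_ h3
  exact_mod_cast Nat.isCoprime_iff_coprime.2 (Nat.coprime_two_right.2 hq)

/-- A periodic orbit of a reflective step relation meets the half-integers either nowhere or
exactly once in each period modulo integer translations. -/
lemma ncard_half_integers (hR : IsReflectiveStep R) (hX : ∀ i, R (X i) (X (i + 1))) {N c n : ℕ}
    (hN : Odd N) (hc : Nat.Coprime c N) (hper : ∀ i, X (i + N) = X i + c * n) :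
    {i : ℕ | i < N ∧ ∃ m : ℤ, 2 * X i = m}.ncard = 0 ∨
      {i : ℕ | i < N ∧ ∃ m : ℤ, 2 * X i = m}.ncard = Nat.gcd n N := by
  have hNpos : 0 < N := hN.pos
  obtain ⟨d, n', q, hd, hco, hn, hNq⟩ := Nat.exists_coprime' (Nat.gcd_pos_of_pos_right n hNpos)
  have hqN : q ∣ N := Dvd.intro _ hNq.symm
  have hqpos : 0 < q := Nat.pos_of_dvd_of_pos hqN hNpos
  have hqodd : Odd q := hN.of_dvd_nat hqN
  have hqp : Nat.Coprime q (c * n') :=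
    Nat.Coprime.mul_right ((hc.coprime_dvd_right hqN).symm) hco.symm
  have hdg : Nat.gcd n N = d := by
    rw [hn, hNq, Nat.gcd_mul_right, hco, one_mul]
  have hperq : ∀ i, X (i + q) = X i + (c * n' : ℕ) := by
    refine hR.apply_add_eq hX hd fun i => ?_
    have := hper i
    rw [hn, hNq] at this
    push_cast at this ⊢
    rw [mul_comm (d : ℤ), this]
    ring
  rcases Set.eq_empty_or_nonempty {i : ℕ | i < N ∧ ∃ m : ℤ, 2 * X i = m} with he | ⟨i, hi, m, him⟩
  · left
    rw [he, Set.ncard_empty]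
  · right
    have hset : {i : ℕ | i < N ∧ ∃ m : ℤ, 2 * X i = m} =
        ((Finset.range N).filter (· ≡ i [MOD q]) : Finset ℕ) := by
      ext j
      simp only [Set.mem_ofPred_eq, Finset.coe_filter, Finset.mem_range]
      refine and_congr_right fun _ => ⟨?_, fun h => ?_⟩
      · rintro ⟨m', hjm⟩
        exact Nat.modEq_iff_dvd.2 (hR.dvd_of_two_mul_eq hX hqodd hqp hperq him hjm)
      · obtain ⟨k, hk⟩ := Nat.modEq_iff_dvd.1 h.symm
        have := apply_add_mul_eq hperq i k
        rw [show (i : ℤ) + k * q = j by lia] at this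
        exact ⟨m + 2 * (k * (c * n' : ℕ)), by rw [this]; push_cast; linarith⟩
    rw [hset, Set.ncard_coe_finset, ← Nat.count_eq_card_filter_range,
      Nat.count_modEq_card N hqpos, hdg, Nat.mod_eq_zero_of_dvd hqN,
      if_neg (Nat.not_lt_zero _), add_zero, hNq, Nat.mul_div_cancel_left _ hqpos]

end IsReflectiveStep

lemma isReflectiveStep_isStep {n : ℕ} (hn : 6 ≤ n) {r : ℝ} (hr : r ≤ rpoly n) :
    IsReflectiveStep (IsStep n r) where
  add_intCast := IsStep.add_intCast
  neg := IsStep.neg hn hr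
  eq := IsStep.eq_of_left_eq
  lt := IsStep.lt_of_left_lt hn hr

/-- A point `y` of the polygon that is the first one at distance `r > 0` counterclockwise from
`polygonPath n x` is the end of a step from `x`. -/
lemma isStep_of_polyDist {n : ℕ} (hn : 3 ≤ n) {r x : ℝ} (hr : 0 < r) {y : ℂ} (hy : y ∈ polygon n)
    (hd : dist (polygonPath n x) y = r)
    (hb : ∀ z ∈ polygon n, SCCWBtw n (polygonPath n x) z y → dist (polygonPath n x) z < r) :
    polygonPath n (x + n * polyDist n (polygonPath n x) y) = y ∧
      IsStep n r x (x + n * polyDist n (polygonPath n x) y) := by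
  obtain ⟨t, rfl⟩ := exists_polygonPath_eq hy
  have hn0 : n ≠ 0 := by lia
  have hnpos : (0 : ℝ) < n := by exact_mod_cast Nat.pos_of_ne_zero hn0
  simp only [SCCWBtw] at hb
  rw [polyDist_polygonPath hn] at hb ⊢
  set f := Int.fract ((t - x) / n) with hf
  have hf0 : 0 ≤ f := Int.fract_nonneg _
  have hf1 : f < 1 := Int.fract_lt_one _
  have hpt : polygonPath n (x + n * f) = polygonPath n t := by
    rw [← polygonPath_add_mul_self hn0 t (-⌊(t - x) / n⌋)]
    congr 1
    rw [hf, Int.fract]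
    push_cast
    field_simp
    ring
  have hfpos : 0 < f := by
    refine lt_of_le_of_ne hf0 fun h0 => ?_
    rw [← h0, mul_zero, add_zero] at hpt
    rw [hpt, dist_self] at hd
    exact hr.ne hd
  refine ⟨hpt, by linarith [mul_pos hnpos hfpos], by rw [hpt, hd], fun z hz1 hz2 => ?_⟩
  refine hb _ (polygonPath_mem_polygon hn0 z) ?_
  have h0 : 0 < (z - x) / n := div_pos (by linarith) hnpos
  have h1 : (z - x) / n < f := by
    rw [div_lt_iff₀ hnpos]
    linarith
  rw [polyDist_polygonPath hn, Int.fract_eq_self.2 ⟨h0.le, h1.trans hf1⟩]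
  exact ⟨h0, h1⟩

lemma IsStar.exists_orbit {n l : ℕ} (hn : 3 ≤ n) {r : ℝ} (hr : 0 < r) {p : ℂ} {u : ℕ → ℂ}
    (hs : IsStar n l r p u) :
    ∃ X : ℤ → ℝ, (∀ i, IsStep n r (X i) (X (i + 1))) ∧
      (∀ i, X (i + (2 * l + 1 : ℕ)) = X i + l * n) ∧
      ∀ i : ℕ, i < 2 * l + 1 → polygonPath n (X i) = u i := by
  obtain ⟨hu0, huN, hmem, hdist, hbtw, hsum⟩ := hs
  obtain ⟨t, ht⟩ := exists_polygonPath_eq (hmem 0 (Nat.zero_le _))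
  set x : ℕ → ℝ := fun k => t + ∑ i ∈ Finset.range k, n * polyDist n (u i) (u (i + 1)) with hx
  have hx0 : x 0 = t := by simp [hx]
  have hxs : ∀ k, x (k + 1) = x k + n * polyDist n (u k) (u (k + 1)) := by
    intro k
    simp only [hx, Finset.sum_range_succ]
    ring
  have hxN : x (2 * l + 1) = x 0 + l * n := by
    simp only [hx, ← Finset.mul_sum, hsum, Finset.range_zero, Finset.sum_empty]
    ring
  have hstep : ∀ k ≤ 2 * l, polygonPath n (x k) = u k →
      polygonPath n (x (k + 1)) = u (k + 1) ∧ IsStep n r (x k) (x (k + 1)) := by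
    intro k hk h
    rw [hxs, ← h]
    exact isStep_of_polyDist hn hr (hmem (k + 1) (by lia)) (by rw [h, hdist k hk])
      (by rw [h]; exact hbtw k hk)
  have hpath : ∀ k ≤ 2 * l + 1, polygonPath n (x k) = u k := by
    intro k
    induction k with
    | zero =>
      intro _
      rw [hx0, ht]
    | succ k ih => exact fun hk => (hstep k (by lia) (ih (by lia))).1
  set N : ℤ := ((2 * l + 1 : ℕ) : ℤ) with hN
  have hNpos : 0 < N := by lia
  set X : ℤ → ℝ := fun i => x (i % N).toNat + (i / N : ℤ) * (l * n) with hX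
  have hXlt : ∀ (a : ℤ) (b : ℕ), b < 2 * l + 1 → X (b + a * N) = x b + a * (l * n) := by
    intro a b hb
    have h1 : ((b : ℤ) + a * N) % N = b := by
      rw [Int.add_mul_emod_self_right, Int.emod_eq_of_lt (by lia) (by lia)]
    have h2 : ((b : ℤ) + a * N) / N = a := by
      rw [Int.add_mul_ediv_right _ _ hNpos.ne', Int.ediv_eq_zero_of_lt (by lia) (by lia), zero_add]
    simp only [hX, h1, h2, Int.toNat_natCast]
  have hXle : ∀ (a : ℤ) (b : ℕ), b ≤ 2 * l + 1 → X (b + a * N) = x b + a * (l * n) := by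
    intro a b hb
    rcases hb.lt_or_eq with hb | rfl
    · exact hXlt a b hb
    · have := hXlt (a + 1) 0 (by lia)
      rw [show ((0 : ℕ) : ℤ) + (a + 1) * N = N + a * N by push_cast; ring] at this
      rw [← hN, this, hxN]
      push_cast
      ring
  have hdecomp : ∀ i : ℤ, ∃ (a : ℤ) (b : ℕ), b < 2 * l + 1 ∧ i = b + a * N := by
    intro i
    have h0 := Int.emod_nonneg i hNpos.ne'
    have h1 := Int.emod_lt_of_pos i hNpos
    refine ⟨i / N, (i % N).toNat, by lia, ?_⟩
    rw [Int.toNat_of_nonneg h0, mul_comm]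
    exact (Int.emod_add_mul_ediv i N).symm
  refine ⟨X, fun i => ?_, fun i => ?_, fun i hi => ?_⟩
  · obtain ⟨a, b, hb, rfl⟩ := hdecomp i
    rw [show (b : ℤ) + a * N + 1 = (b + 1 : ℕ) + a * N by push_cast; ring, hXle a b hb.le,
      hXle a (b + 1) hb]
    have := (hstep b (by lia) (hpath b hb.le)).2.add_intCast (a * (l * n))
    push_cast at this
    exact this
  · obtain ⟨a, b, hb, rfl⟩ := hdecomp i
    rw [show (b : ℤ) + a * N + N = b + (a + 1) * N by ring, hXle _ b hb.le, hXle _ b hb.le]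
    push_cast
    ring
  · have := hXlt 0 i hi
    rw [zero_mul, add_zero] at this
    rw [this, Int.cast_zero, zero_mul, add_zero, hpath i hi.le]

/-- Coincidence number: for an inscribed equilateral `(2l+1)`-pointed star in `P_n` of side
length `r ∈ (0, r_n]`, the number of indices `i ∈ {0, …, 2l}` for which `u i` is a vertex of
`P_n` or a midpoint of an edge of `P_n` is either `0` or `gcd(n, 2l+1)`. -/
theorem coincidence_number (l n : ℕ) (hl : 1 ≤ l) (hn : 4 * l + 2 ≤ n)
    (r : ℝ) (hr0 : 0 < r) (hrn : r ≤ rpoly n) (p : ℂ) (u : ℕ → ℂ)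
    (hs : IsStar n l r p u) :
    {i : ℕ | i ≤ 2 * l ∧ (IsVertex n (u i) ∨ IsMidpoint n (u i))}.ncard = 0 ∨
    {i : ℕ | i ≤ 2 * l ∧ (IsVertex n (u i) ∨ IsMidpoint n (u i))}.ncard =
      Nat.gcd n (2 * l + 1) := by
  obtain ⟨X, hX, hper, hpath⟩ := hs.exists_orbit (by lia) hr0
  have hset : {i : ℕ | i ≤ 2 * l ∧ (IsVertex n (u i) ∨ IsMidpoint n (u i))} =
      {i : ℕ | i < 2 * l + 1 ∧ ∃ m : ℤ, 2 * X i = m} := by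
    ext i
    simp only [Set.mem_ofPred_eq, Nat.lt_succ_iff]
    refine and_congr_right fun hi => ?_
    rw [← hpath i (by lia), isVertex_or_isMidpoint_polygonPath_iff (by lia)]
  have hco : Nat.Coprime l (2 * l + 1) := by simp
  rw [hset]
  exact (isReflectiveStep_isStep (by lia) hrn).ncard_half_integers hX ⟨l, rfl⟩ hco hper
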